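/- arXiv:2205.04106 — 2 statements merged into one kernel-verified Lean document; each statement's English description precedes it below -/
import Mathlib

section
/- For every integer d ≥ 1 and every integer α with 0 ≤ α ≤ d−1 there exists a constant C_{α,d} > 0 such that for all m ∈ ℕ and all τ > 0, |(τ d/dτ)^α ( L_m^{(d-1)}(τ) e^{-τ/2} )| ≤ C_{α,d} (2m+d)^{d-1}, where (τ d/dτ)^α denotes the α-fold application of the operator h ↦ τ·h'. -/
/-- Laguerre polynomial of type `d` and degree `m`. -/
noncomputable def laguerreL (d m : ℕ) (t : ℝ) : ℝ :=
  ∑ k ∈ Finset.range (m + 1),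
    (-1 : ℝ) ^ k * (Nat.choose (m + d) (m - k)) * t ^ k / (Nat.factorial k)

/-- The operator `h ↦ τ·h'` on functions of `τ`. -/
noncomputable def tauD (h : ℝ → ℝ) : ℝ → ℝ := fun τ => τ * deriv h τ

open Finset in
lemma lag_ext (a m M : ℕ) (h : m + 1 ≤ M) (t : ℝ) :
    laguerreL a m t = ∑ k ∈ range M, (-1 : ℝ) ^ k * (Nat.choose (m + a) (a + k)) * t ^ k / (Nat.factorial k) := by
  unfold laguerreL
  rw [← Finset.sum_subset (Finset.range_subset_range.2 h)]
  · apply Finset.sum_congr rfl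
    intro k hk
    have hk' : k ≤ m := by simpa [Nat.lt_succ_iff] using hk
    rw [Nat.choose_symm_of_eq_add (show m + a = (m - k) + (a + k) by omega)]
  · intro k _ hk
    have : m + a < a + k := by
      simp at hk; omega
    rw [Nat.choose_eq_zero_of_lt this]; simp

lemma lag_succ (a m : ℕ) (t : ℝ) :
    laguerreL (a+1) (m+1) t = laguerreL (a+1) m t + laguerreL a (m+1) t := by
  rw [lag_ext (a+1) (m+1) (m+2) (by omega), lag_ext (a+1) m (m+2) (by omega),
    lag_ext a (m+1) (m+2) (by omega), ← Finset.sum_add_distrib]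
  apply Finset.sum_congr rfl
  intro k _
  have : Nat.choose (m + 1 + (a+1)) (a + 1 + k) =
      Nat.choose (m + (a+1)) (a+1+k) + Nat.choose (m + 1 + a) (a + k) := by
    rw [show m + 1 + (a+1) = (m + 1 + a) + 1 by ring, show a + 1 + k = (a + k) + 1 by ring,
      Nat.choose_succ_succ, show m + (a+1) = m + 1 + a by ring, add_comm]
  rw [this]; push_cast; ring

lemma lag_hasDeriv (a m : ℕ) (t : ℝ) :
    HasDerivAt (laguerreL a m) (∑ k ∈ Finset.range (m+2),
      (-1 : ℝ) ^ k * (Nat.choose (m + a) (a + k)) * (k * t ^ (k-1)) / (Nat.factorial k)) t := by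
  have : laguerreL a m = fun t => ∑ k ∈ Finset.range (m+2),
      (-1 : ℝ) ^ k * (Nat.choose (m + a) (a + k)) * t ^ k / (Nat.factorial k) := by
    ext t; exact lag_ext a m (m+2) (by omega) t
  rw [this]
  apply HasDerivAt.fun_sum
  intro k _
  exact ((hasDerivAt_pow k t).const_mul _).div_const _

lemma choose_id (N K : ℕ) : ((K:ℝ)+1) * (Nat.choose (N+1) (K+1)) = (N+1) * Nat.choose N K := by
  have := Nat.add_one_mul_choose_eq N K
  have h : (((N + 1) * N.choose K : ℕ):ℝ) = (((N + 1).choose (K + 1) * (K + 1) : ℕ) : ℝ) := by rw [this]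
  push_cast at h; linarith

lemma choose_id2 (N K : ℕ) : ((N:ℝ)+1-K) * (Nat.choose (N+1) K) = (N+1) * Nat.choose N K := by
  have h1 := choose_id N K
  have h2 : ((N+1).choose (K+1) : ℝ) * (K+1) = (N+1).choose K * ((N:ℝ)+1-K) := by
    rcases le_or_gt K (N+1) with h | h
    · have := Nat.choose_succ_right_eq (N+1) K
      have h3 : (((N+1).choose (K+1) * (K+1) : ℕ):ℝ) = (((N+1).choose K * (N+1-K) : ℕ) : ℝ) := by rw [this]
      push_cast [Nat.cast_sub h] at h3; exact h3
    · rw [Nat.choose_eq_zero_of_lt h, Nat.choose_eq_zero_of_lt (by omega)]; simp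
  linarith

/-- The Laguerre functions. -/
noncomputable def lagF (a m : ℕ) : ℝ → ℝ := fun τ => laguerreL a m τ * Real.exp (-τ / 2)

lemma tauD_lagF (a m : ℕ) : tauD (lagF (a+1) m) = fun τ =>
    ((m:ℝ)+1)/2 * lagF a (m+1) τ + (((m:ℝ)+a+1)/2 * lagF a m τ + (-((a:ℝ)+1)) * lagF (a+1) m τ) := by
  ext t
  have hexp : HasDerivAt (fun τ : ℝ => Real.exp (-τ/2)) (Real.exp (-t/2) * (-1/2)) t :=
    (((hasDerivAt_id t).neg).div_const 2).exp
  have hd := (lag_hasDeriv (a+1) m t).mul hexp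
  have hd' : HasDerivAt (lagF (a+1) m) _ t := hd
  unfold tauD
  rw [hd'.deriv]
  unfold lagF
  have key : t * (∑ k ∈ Finset.range (m+2),
      (-1 : ℝ) ^ k * (Nat.choose (m + (a+1)) (a+1 + k)) * (k * t ^ (k-1)) / (Nat.factorial k))
      = 1/2 * (t * laguerreL (a+1) m t) + ((m:ℝ)+1)/2 * laguerreL a (m+1) t + (((m:ℝ)+a+1)/2 * laguerreL a m t
        + (-((a:ℝ)+1)) * laguerreL (a+1) m t) := by
    rw [lag_ext a (m+1) (m+2) (by omega), lag_ext a m (m+2) (by omega)]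
    have e1 : t * laguerreL (a+1) m t = ∑ k ∈ Finset.range (m+2),
        - ((-1 : ℝ) ^ k * k * (Nat.choose (m + (a+1)) (a + k)) * t ^ k / (Nat.factorial k)) := by
      rw [Finset.sum_range_succ', lag_ext (a+1) m (m+1) le_rfl, Finset.mul_sum]
      simp only [Nat.cast_zero, mul_zero, zero_mul, zero_div, neg_zero, add_zero]
      apply Finset.sum_congr rfl
      intro k _
      rw [Nat.factorial_succ, show a + 1 + k = a + (k+1) by ring]
      have := Nat.factorial_ne_zero k
      push_cast
      field_simp
      ring
    rw [e1, lag_ext (a+1) m (m+2) (by omega)]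
    simp only [Finset.mul_sum, ← Finset.sum_add_distrib]
    apply Finset.sum_congr rfl
    intro k _
    have h1 := choose_id (m+a) (a+k)
    have h2 := choose_id2 (m+a) (a+k)
    rw [show m + (a+1) = m+a+1 by ring, show a + 1 + k = a + k + 1 by ring,
      show m + 1 + a = m + a + 1 by ring]
    have hk : (k:ℝ) * t^(k-1) * t = k * t^k := by
      cases k with
      | zero => simp
      | succ k => simp [pow_succ]; ring
    push_cast at h1 h2
    have := Nat.factorial_ne_zero k
    field_simp
    set X : ℝ := ((m+a+1).choose (a+k+1) : ℝ)
    set Y : ℝ := ((m+a+1).choose (a+k) : ℝ)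
    set Z : ℝ := ((m+a).choose (a+k) : ℝ)
    linear_combination 2 * X * hk + t^k * (2 * h1 - h2)
  linear_combination Real.exp (-t/2) * key

/-- Raising operator. -/
noncomputable def chS : Module.End ℝ (ℕ → ℝ) where
  toFun g := fun n => n * g (n-1)
  map_add' f g := by ext n; simp [mul_add]
  map_smul' c f := by ext n; simp; ring

/-- Charlier polynomials. -/
noncomputable def chP (t : ℝ) (m : ℕ) : ℕ → ℝ := ((chS + algebraMap ℝ _ (-t))^m) (fun _ => 1)

lemma chP_succ (t : ℝ) (m n : ℕ) : chP t (m+1) n = n * chP t m (n-1) - t * chP t m n := by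
  unfold chP
  rw [pow_succ']
  simp [chS, Module.algebraMap_end_apply]
  ring

lemma chP_zero (t : ℝ) (n : ℕ) : chP t 0 n = 1 := by simp [chP]

lemma chS_pow (k n : ℕ) : (chS^k) (fun _ => 1) n = (n.descFactorial k : ℝ) := by
  induction k generalizing n with
  | zero => simp
  | succ k ih =>
    rw [pow_succ']
    show (n:ℝ) * (chS^k) (fun _ => 1) (n-1) = _
    rw [ih]
    cases n with
    | zero => simp
    | succ n => rw [Nat.succ_descFactorial_succ]; push_cast; simp

lemma chP_expl (t : ℝ) (m n : ℕ) : chP t m n =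
    ∑ k ∈ Finset.range (m+1), (n.descFactorial k : ℝ) * (-t)^(m-k) * (m.choose k) := by
  unfold chP
  have hc : Commute chS (algebraMap ℝ (Module.End ℝ (ℕ → ℝ)) (-t)) := (Algebra.commutes (-t) chS).symm
  rw [hc.add_pow, LinearMap.sum_apply, Finset.sum_apply]
  apply Finset.sum_congr rfl
  intro k _
  rw [← chS_pow, ← map_pow]
  have : ((m.choose k : ℕ) : Module.End ℝ (ℕ → ℝ)) = algebraMap ℝ _ (m.choose k : ℝ) := by simp
  rw [this, mul_assoc, ← map_mul, ← Algebra.commutes]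
  rw [Module.End.mul_apply, Module.algebraMap_end_apply, Pi.smul_apply, smul_eq_mul]
  ring

lemma chP_diag (t : ℝ) (m : ℕ) : chP t m m = m.factorial * laguerreL 0 m t := by
  rw [chP_expl, laguerreL, Finset.mul_sum, ← Finset.sum_range_reflect]
  apply Finset.sum_congr rfl
  intro k hk
  have hk' : k ≤ m := by simpa [Nat.lt_succ_iff] using hk
  rw [show m + 1 - 1 - k = m - k by omega, show m - (m-k) = k by omega]
  have h := Nat.factorial_mul_descFactorial (show m - k ≤ m by omega)
  rw [show m - (m-k) = k by omega] at h
  have h' : (k.factorial : ℝ) * m.descFactorial (m-k) = m.factorial := by exact_mod_cast h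
  have := Nat.factorial_ne_zero k
  rw [← h', neg_pow]
  field_simp
  simp

lemma chP_diff (t : ℝ) (m n : ℕ) : chP t (m+1) (n+1) - chP t (m+1) n = (m+1) * chP t m n := by
  induction m generalizing n with
  | zero => rw [chP_succ, chP_succ]; simp [chP_zero]
  | succ m ih =>
    rw [chP_succ t (m+1) (n+1), chP_succ t (m+1) n]
    have h1 := ih n
    have h2 : (n:ℝ) * (chP t (m+1) n - chP t (m+1) (n-1)) = n * ((m+1) * chP t m (n-1)) := by
      cases n with
      | zero => simp
      | succ n => rw [← ih]; simp
    have h3 := chP_succ t m n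
    push_cast
    linear_combination h2 - t * h1 - (m+1) * h3

lemma chP_bound (t : ℝ) (ht : 0 ≤ t) (m n : ℕ) : |chP t m n| ≤ (1+t)^m * (2^m)^n := by
  induction m generalizing n with
  | zero => simp [chP_zero]
  | succ m ih =>
    rw [chP_succ]
    have hn : (n:ℝ) ≤ 2^n := by exact_mod_cast n.lt_two_pow_self.le
    have h1 : |chP t m (n-1)| ≤ (1+t)^m * (2^m)^n := by
      refine (ih (n-1)).trans ?_
      gcongr
      · exact one_le_pow₀ (by norm_num)
      · omega
    have h2 := ih n
    have h3 : (1:ℝ) ≤ 2^n := one_le_pow₀ (by norm_num)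
    set B : ℝ := (1+t)^m * (2^m)^n
    have hB : 0 ≤ B := by positivity
    calc |n * chP t m (n-1) - t * chP t m n| ≤ |n * chP t m (n-1)| + |t * chP t m n| := abs_sub _ _
      _ = n * |chP t m (n-1)| + t * |chP t m n| := by
        rw [abs_mul, abs_mul, abs_of_nonneg ht, abs_of_nonneg (Nat.cast_nonneg n)]
      _ ≤ 2^n * B + t * B := by gcongr
      _ ≤ 2^n * B + t * B * 2^n := by nlinarith [mul_nonneg ht hB]
      _ = _ := by simp only [B]; rw [pow_succ 2 m, mul_pow]; ring

lemma ch_summable (t : ℝ) (ht : 0 ≤ t) (g : ℕ → ℝ) (A B : ℝ) (hg : ∀ n, |g n| ≤ A * B^n) :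
    Summable (fun n : ℕ => t^n / n.factorial * g n) := by
  apply Summable.of_norm_bounded (g := fun n => A * ((t*B)^n / n.factorial))
  · exact (Real.summable_pow_div_factorial _).mul_left _
  · intro n
    rw [Real.norm_eq_abs, abs_mul, abs_of_nonneg (by positivity)]
    calc t^n / n.factorial * |g n| ≤ t^n / n.factorial * (A * B^n) := by gcongr; exact hg n
      _ = _ := by rw [mul_pow]; ring

lemma ch_sum2 (t : ℝ) (ht : 0 ≤ t) (m k : ℕ) (i : ℕ) :
    Summable (fun n : ℕ => t^n / n.factorial * (chP t m n * chP t k (n+i))) := by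
  apply ch_summable t ht _ ((1+t)^m * (1+t)^k * (2^k)^i) (2^m*2^k)
  intro n
  rw [abs_mul]
  calc _ ≤ ((1+t)^m * (2^m)^n) * ((1+t)^k * (2^k)^(n+i)) := by
        gcongr
        · exact chP_bound t ht m n
        · exact chP_bound t ht k _
    _ = _ := by rw [mul_pow, pow_add]; ring

lemma ch_norm (t : ℝ) (ht : 0 ≤ t) (m : ℕ) :
    ∑' n : ℕ, t^n / n.factorial * (chP t m n * chP t m n) = Real.exp t * (m.factorial * t^m) := by
  induction m with
  | zero => simp [chP_zero, Real.exp_eq_exp_ℝ, NormedSpace.exp_eq_tsum_div]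
  | succ m ih =>
    have s0 := ch_sum2 t ht m (m+1) 0
    have s1 := ch_sum2 t ht m (m+1) 1
    simp only [add_zero] at s0
    have sA := ch_sum2 t ht (m+1) (m+1) 0
    simp only [add_zero] at sA
    have sB : Summable (fun n : ℕ => t^n / n.factorial * (n * chP t m (n-1) * chP t (m+1) n)) := by
      refine (sA.add (s0.mul_left t)).congr ?_
      intro n
      rw [chP_succ t m n]; ring
    have eB : ∑' n : ℕ, t^n / n.factorial * (n * chP t m (n-1) * chP t (m+1) n)
        = t * ∑' n : ℕ, t^n / n.factorial * (chP t m n * chP t (m+1) (n+1)) := by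
      rw [sB.tsum_eq_zero_add, ← tsum_mul_left]
      simp only [Nat.cast_zero, zero_mul, mul_zero, zero_add]
      apply tsum_congr
      intro n
      rw [Nat.factorial_succ]
      have := Nat.factorial_ne_zero n
      push_cast
      field_simp
      ring
    have eA : ∑' n : ℕ, t^n / n.factorial * (chP t (m+1) n * chP t (m+1) n)
        = t * ∑' n : ℕ, t^n / n.factorial * (chP t m n * chP t (m+1) (n+1))
          - t * ∑' n : ℕ, t^n / n.factorial * (chP t m n * chP t (m+1) n) := by
      rw [← eB, ← tsum_mul_left, ← sB.tsum_sub (s0.mul_left t)]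
      apply tsum_congr
      intro n
      rw [chP_succ t m n]; ring
    rw [eA, ← mul_sub, ← s1.tsum_sub s0]
    have : ∀ n : ℕ, t^n / n.factorial * (chP t m n * chP t (m+1) (n+1)) -
        t^n / n.factorial * (chP t m n * chP t (m+1) n) =
        (m+1) * (t^n / n.factorial * (chP t m n * chP t m n)) := by
      intro n
      linear_combination t^n / n.factorial * chP t m n * chP_diff t m n
    rw [tsum_congr this, tsum_mul_left, ih, Nat.factorial_succ]
    push_cast; ring

lemma lag0_bound (m : ℕ) (t : ℝ) (ht : 0 < t) : |lagF 0 m t| ≤ 1 := by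
  have sA := ch_sum2 t ht.le m m 0
  simp only [add_zero] at sA
  have h := sA.le_tsum m (fun n _ => mul_nonneg (by positivity) (mul_self_nonneg _))
  rw [ch_norm t ht.le, chP_diag] at h
  have hm : (0:ℝ) < m.factorial := by exact_mod_cast Nat.factorial_pos m
  have h2 : (laguerreL 0 m t)^2 ≤ Real.exp t := by
    have e : t^m / m.factorial * (m.factorial * laguerreL 0 m t * (m.factorial * laguerreL 0 m t))
        = (laguerreL 0 m t)^2 * (m.factorial * t^m) := by field_simp
    rw [e] at h
    exact le_of_mul_le_mul_right h (by positivity)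
  rw [← sq_le_one_iff_abs_le_one, lagF, mul_pow, ← Real.exp_nat_mul]
  calc _ ≤ Real.exp t * Real.exp (((2:ℕ):ℝ) * (-t/2)) := by gcongr
    _ = 1 := by rw [← Real.exp_add]; norm_num; ring

lemma lagF_bound (a m : ℕ) (t : ℝ) (ht : 0 < t) : |lagF a m t| ≤ ((m:ℝ)+1)^a := by
  induction a generalizing m with
  | zero => simpa using lag0_bound m t ht
  | succ a iha =>
    induction m with
    | zero =>
      have : lagF (a+1) 0 t = lagF a 0 t := by simp [lagF, laguerreL]
      rw [this]; simpa using iha 0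
    | succ m ihm =>
      have : lagF (a+1) (m+1) t = lagF (a+1) m t + lagF a (m+1) t := by
        simp only [lagF]; rw [lag_succ]; ring
      rw [this]
      have h1 := iha (m+1)
      push_cast at *
      calc _ ≤ |lagF (a+1) m t| + |lagF a (m+1) t| := abs_add_le _ _
        _ ≤ ((m:ℝ)+1)^(a+1) + ((m:ℝ)+1+1)^a := add_le_add ihm h1
        _ ≤ ((m:ℝ)+1+1)^a * (m+1) + ((m:ℝ)+1+1)^a := by
          rw [pow_succ]; gcongr; linarith
        _ = _ := by ring

lemma tauD_smooth {f : ℝ → ℝ} (hf : ContDiff ℝ (⊤ : ℕ∞) f) : ContDiff ℝ (⊤ : ℕ∞) (tauD f) := by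
  have : ContDiff ℝ (⊤ : ℕ∞) (deriv f) := ((contDiff_infty_iff_deriv).1 hf).2
  exact contDiff_id.mul this

lemma lagF_smooth (a m : ℕ) : ContDiff ℝ (⊤ : ℕ∞) (lagF a m) := by
  unfold lagF laguerreL
  fun_prop

lemma tauD_lin {f g : ℝ → ℝ} (hf : ContDiff ℝ (⊤ : ℕ∞) f) (hg : ContDiff ℝ (⊤ : ℕ∞) g) (b c : ℝ) (n : ℕ) :
    tauD^[n] (fun τ => b * f τ + c * g τ) = fun τ => b * tauD^[n] f τ + c * tauD^[n] g τ := by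
  induction n generalizing f g with
  | zero => rfl
  | succ n ih =>
    simp only [Function.iterate_succ, Function.comp]
    rw [← ih (tauD_smooth hf) (tauD_smooth hg)]
    congr 1
    ext t
    have h1 := (hf.differentiable (by simp) t).hasDerivAt.const_mul b
    have h2 := (hg.differentiable (by simp) t).hasDerivAt.const_mul c
    simp only [tauD]
    rw [(h1.fun_add h2).deriv]; ring

lemma main_bound (α : ℕ) : ∀ a, α ≤ a → ∃ C : ℝ, 0 < C ∧ ∀ (m : ℕ) (τ : ℝ), 0 < τ →
    |tauD^[α] (lagF a m) τ| ≤ C * ((m:ℝ)+1)^a := by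
  induction α with
  | zero =>
    intro a _
    exact ⟨1, one_pos, fun m τ h => by simpa using lagF_bound a m τ h⟩
  | succ α ih =>
    intro a ha
    obtain ⟨a, rfl⟩ : ∃ b, a = b + 1 := ⟨a - 1, by omega⟩
    obtain ⟨C1, hC1, h1⟩ := ih a (by omega)
    obtain ⟨C2, hC2, h2⟩ := ih (a+1) (by omega)
    refine ⟨C1 * 2^a + (a+1) * C1 + (a+1) * C2, by positivity, ?_⟩
    intro m τ hτ
    have hlin : tauD^[α+1] (lagF (a+1) m) τ = ((m:ℝ)+1)/2 * tauD^[α] (lagF a (m+1)) τ +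
        (((m:ℝ)+a+1)/2 * tauD^[α] (lagF a m) τ + (-((a:ℝ)+1)) * tauD^[α] (lagF (a+1) m) τ) := by
      rw [Function.iterate_succ, Function.comp, tauD_lagF]
      have hs : ContDiff ℝ (⊤ : ℕ∞) (fun τ => ((m:ℝ)+a+1)/2 * lagF a m τ + (-((a:ℝ)+1)) * lagF (a+1) m τ) :=
        (contDiff_const.mul (lagF_smooth _ _)).add (contDiff_const.mul (lagF_smooth _ _))
      have e := tauD_lin (lagF_smooth a (m+1)) hs (((m:ℝ)+1)/2) 1 α
      simp only [one_mul] at e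
      rw [e, tauD_lin (lagF_smooth _ _) (lagF_smooth _ _)]
    rw [hlin]
    have b1 := h1 (m+1) τ hτ
    have b2 := h1 m τ hτ
    have b3 := h2 m τ hτ
    have hm : (0:ℝ) ≤ m := Nat.cast_nonneg m
    have ha' : (0:ℝ) ≤ a := Nat.cast_nonneg a
    have hp : (((m+1:ℕ):ℝ)+1)^a ≤ 2^a * ((m:ℝ)+1)^a := by
      rw [← mul_pow]; gcongr; push_cast; linarith
    calc _ ≤ |((m:ℝ)+1)/2 * tauD^[α] (lagF a (m+1)) τ| +
        (|((m:ℝ)+a+1)/2 * tauD^[α] (lagF a m) τ| + |(-((a:ℝ)+1)) * tauD^[α] (lagF (a+1) m) τ|) :=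
          (abs_add_le _ _).trans (by gcongr; exact abs_add_le _ _)
      _ = ((m:ℝ)+1)/2 * |tauD^[α] (lagF a (m+1)) τ| +
        (((m:ℝ)+a+1)/2 * |tauD^[α] (lagF a m) τ| + ((a:ℝ)+1) * |tauD^[α] (lagF (a+1) m) τ|) := by
          rw [abs_mul, abs_mul, abs_mul, abs_neg, abs_of_nonneg (by positivity : (0:ℝ) ≤ ((m:ℝ)+1)/2),
            abs_of_nonneg (by positivity : (0:ℝ) ≤ ((m:ℝ)+a+1)/2), abs_of_nonneg (by positivity : (0:ℝ) ≤ (a:ℝ)+1)]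
      _ ≤ ((m:ℝ)+1) * (C1 * (2^a * ((m:ℝ)+1)^a)) +
        ((((a:ℝ)+1) * (m+1)) * (C1 * ((m:ℝ)+1)^a) + ((a:ℝ)+1) * (C2 * ((m:ℝ)+1)^(a+1))) := by
          gcongr
          · linarith
          · exact b1.trans (by gcongr)
          · nlinarith [mul_nonneg hm ha']
      _ = _ := by ring

/-- Improved estimate for the Laguerre functions: for `0 ≤ α ≤ d-1`,
`|(τ d/dτ)^α (L_m^{(d-1)}(τ) e^{-τ/2})| ≤ C_{α,d} (2m+d)^{d-1}`. -/
theorem statement5 (d : ℕ) (hd : 1 ≤ d) (α : ℕ) (hα : α ≤ d - 1) :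
    ∃ C : ℝ, 0 < C ∧ ∀ (m : ℕ) (τ : ℝ), 0 < τ →
      |tauD^[α] (fun τ => laguerreL (d - 1) m τ * Real.exp (-τ / 2)) τ| ≤
        C * (2 * (m : ℝ) + d) ^ ((d : ℝ) - 1) := by
  obtain ⟨C, hC, h⟩ := main_bound α (d-1) hα
  refine ⟨C, hC, fun m τ hτ => (h m τ hτ).trans ?_⟩
  have hd' : (1:ℝ) ≤ d := by exact_mod_cast hd
  have hm : (0:ℝ) ≤ m := Nat.cast_nonneg m
  have e : (d:ℝ) - 1 = ((d-1 : ℕ) : ℝ) := by push_cast [Nat.cast_sub hd]; rfl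
  rw [e, Real.rpow_natCast]
  gcongr
  linarith
end

section
/- Let n ≥ 1 and 0 < α < 1, and set s₀ = α·4^α·n^α. Then there exists ε ∈ (0,1) such that for every smooth compactly supported Q : ℝ → ℝ with support contained in (1−ε, 1+ε) and Q(1) = 1, there exist constants c₁, c₂, T > 0 such that for all t ≥ T, c₁ t^{−1/2} ≤ | ∫_ℝ e^{i t (−λ s₀ + 4^α n^α λ^α)} Q(λ) λ^n dλ | ≤ c₂ t^{−1/2}. (This shows the decay rate |t|^{−1/2} for the fractional Schrödinger semigroup e^{it𝓛^α} on the Heisenberg group is sharp.) -/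
open MeasureTheory
open Filter Topology

noncomputable def spF (φ p q g g' : ℝ → ℝ) (s u : ℝ) : ℂ :=
  ((g' u : ℂ) / (1 - Complex.I * ((s ^ 2 * (u * p u) : ℝ) : ℂ)) +
    (g u : ℂ) * (Complex.I * ((s ^ 2 * (p u + u * q u) : ℝ) : ℂ)) /
      (1 - Complex.I * ((s ^ 2 * (u * p u) : ℝ) : ℂ)) ^ 2) *
    ((u : ℂ) * Complex.exp (-(Complex.I * ((s ^ 2 * φ u : ℝ) : ℂ))))

lemma sp_normD (w : ℝ) (hw : 0 ≤ w) : (1 + w) / 2 ≤ ‖1 - Complex.I * (w : ℂ)‖ := by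
  have h1 := Complex.abs_re_le_norm (1 - Complex.I * (w : ℂ))
  have h2 := Complex.abs_im_le_norm (1 - Complex.I * (w : ℂ))
  simp [abs_of_nonneg hw] at h1 h2
  linarith

lemma sp_Dne (w : ℝ) : 1 - Complex.I * (w : ℂ) ≠ 0 := by
  intro h
  have := congrArg Complex.re h
  simp at this

lemma sp_normE (w : ℝ) : ‖Complex.exp (-(Complex.I * (w : ℂ)))‖ = 1 := by
  rw [Complex.norm_exp]; simp

lemma sp_bound (φ p q g g' : ℝ → ℝ) (c M C : ℝ) (hc : 0 < c) (hc1 : c ≤ 1) (hM : 0 ≤ M)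
    (hC : 0 ≤ C)
    (h1 : ∀ u, c * u ^ 2 ≤ u * p u) (h2 : ∀ u, |p u + u * q u| ≤ M * |u|)
    (hg : ∀ u, |g u| ≤ C) (hg' : ∀ u, |g' u| * |u| ≤ C) (s u : ℝ) :
    ‖spF φ p q g g' s u‖ ≤ ((2 * C + 4 * (C * M) / c) / c) * (1 + (s * u) ^ 2)⁻¹ := by
  unfold spF
  have hw : c * (s * u) ^ 2 ≤ s ^ 2 * (u * p u) := by
    have := mul_le_mul_of_nonneg_left (h1 u) (sq_nonneg s)
    nlinarith
  set w := s ^ 2 * (u * p u)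
  have hx0 : 0 ≤ (s * u) ^ 2 := sq_nonneg _
  have hD := sp_normD w (by nlinarith)
  set D := 1 - Complex.I * (w : ℂ)
  set X := (s * u) ^ 2 with hX
  have hE : 0 < 1 + c * X := by positivity
  have hD2 : (1 + c * X) / 2 ≤ ‖D‖ := by linarith
  have hDp : 0 < ‖D‖ := by linarith
  rw [norm_mul, norm_mul, sp_normE, mul_one]
  have e1 : ‖(g' u : ℂ) / D‖ * ‖(u : ℂ)‖ ≤ 2 * C / (1 + c * X) := by
    rw [norm_div, Complex.norm_real, Complex.norm_real, Real.norm_eq_abs, Real.norm_eq_abs,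
      div_mul_eq_mul_div, div_le_div_iff₀ hDp hE]
    have := hg' u
    have h3 : 0 ≤ |g' u| * |u| := by positivity
    nlinarith
  have e2 : ‖(g u : ℂ) * (Complex.I * ((s ^ 2 * (p u + u * q u) : ℝ) : ℂ)) / D ^ 2‖ * ‖(u : ℂ)‖
      ≤ 4 * (C * M) / c / (1 + c * X) := by
    rw [norm_div, norm_mul, norm_mul, norm_pow, Complex.norm_I, one_mul, Complex.norm_real,
      Complex.norm_real, Complex.norm_real, Real.norm_eq_abs, Real.norm_eq_abs, Real.norm_eq_abs,
      abs_mul, abs_of_nonneg (sq_nonneg s)]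
    have n1 : |g u| * (s ^ 2 * |p u + u * q u|) * |u| ≤ C * M * X := by
      have : |g u| * (s ^ 2 * |p u + u * q u|) * |u| ≤ C * (s ^ 2 * (M * |u|)) * |u| := by
        gcongr
        · exact hg u
        · exact h2 u
      refine this.trans (le_of_eq ?_)
      rw [hX, mul_pow, ← sq_abs u]; ring
    have n2 : (1 + c * X) ^ 2 / 4 ≤ ‖D‖ ^ 2 := by
      have := pow_le_pow_left₀ (by positivity) hD2 2
      nlinarith
    calc _ = (|g u| * (s ^ 2 * |p u + u * q u|) * |u|) / ‖D‖ ^ 2 := by ring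
      _ ≤ (C * M * X) / ((1 + c * X) ^ 2 / 4) := by gcongr
      _ ≤ 4 * (C * M) / c / (1 + c * X) := by
        rw [div_div, div_le_div_iff₀ (by positivity) (by positivity)]
        have : 0 ≤ C * M := by positivity
        have : 0 ≤ C * M * (1 + c * X) := by positivity
        nlinarith
  calc _ ≤ (‖(g' u : ℂ) / D‖ + ‖(g u : ℂ) * (Complex.I * ((s ^ 2 * (p u + u * q u) : ℝ) : ℂ)) / D ^ 2‖) * ‖(u : ℂ)‖ := by
        gcongr; exact norm_add_le _ _
    _ ≤ 2 * C / (1 + c * X) + 4 * (C * M) / c / (1 + c * X) := by rw [add_mul]; linarith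
    _ = (2 * C + 4 * (C * M) / c) / (1 + c * X) := by ring
    _ ≤ (2 * C + 4 * (C * M) / c) / (c * (1 + X)) := by
        gcongr
        nlinarith
    _ = _ := by rw [← div_div, div_eq_mul_inv _ (1 + X)]

lemma sp_ibp (φ p q g g' : ℝ → ℝ) (c M C : ℝ) (hc : 0 < c) (hc1 : c ≤ 1) (hM : 0 ≤ M)
    (hC : 0 ≤ C)
    (h1 : ∀ u, c * u ^ 2 ≤ u * p u) (h2 : ∀ u, |p u + u * q u| ≤ M * |u|)
    (hg : ∀ u, |g u| ≤ C) (hg' : ∀ u, |g' u| * |u| ≤ C)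
    (dφ : ∀ u, HasDerivAt φ (p u) u) (dp : ∀ u, HasDerivAt p (q u) u) (hq : Continuous q)
    (dg : ∀ u, HasDerivAt g (g' u) u) (cg' : Continuous g') (ig : Integrable g)
    (iug : Integrable (fun u => u * g u)) (s : ℝ) (hs : 0 < s) :
    ∫ u, (g u : ℂ) * Complex.exp (-(Complex.I * ((s ^ 2 * φ u : ℝ) : ℂ))) =
      - ∫ u, spF φ p q g g' s u := by
  have cφ : Continuous φ := continuous_iff_continuousAt.2 fun u => (dφ u).continuousAt
  have cp : Continuous p := continuous_iff_continuousAt.2 fun u => (dp u).continuousAt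
  have cg : Continuous g := continuous_iff_continuousAt.2 fun u => (dg u).continuousAt
  have cD : Continuous fun u : ℝ => (1 - Complex.I * ((s ^ 2 * (u * p u) : ℝ) : ℂ)) := by fun_prop
  have cF : Continuous (spF φ p q g g' s) := by
    unfold spF
    refine Continuous.mul (Continuous.add ?_ ?_) (by fun_prop)
    · exact Continuous.div (by fun_prop) cD fun u => sp_Dne _
    · exact Continuous.div (by fun_prop) (cD.pow 2) fun u => pow_ne_zero _ (sp_Dne _)
  have iF : Integrable (spF φ p q g g' s) := by
    refine Integrable.mono' (g := fun u => ((2 * C + 4 * (C * M) / c) / c) * (1 + (s * u) ^ 2)⁻¹)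
      ?_ cF.aestronglyMeasurable
      (Eventually.of_forall fun u => sp_bound φ p q g g' c M C hc hc1 hM hC h1 h2 hg hg' s u)
    exact (integrable_inv_one_add_sq.comp_mul_left' hs.ne').const_mul _
  let U : ℝ → ℂ := fun u => (g u : ℂ) / (1 - Complex.I * ((s ^ 2 * (u * p u) : ℝ) : ℂ))
  let U' : ℝ → ℂ := fun u => ((g' u : ℂ) / (1 - Complex.I * ((s ^ 2 * (u * p u) : ℝ) : ℂ)) +
    (g u : ℂ) * (Complex.I * ((s ^ 2 * (p u + u * q u) : ℝ) : ℂ)) /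
      (1 - Complex.I * ((s ^ 2 * (u * p u) : ℝ) : ℂ)) ^ 2)
  let V : ℝ → ℂ := fun u => (u : ℂ) * Complex.exp (-(Complex.I * ((s ^ 2 * φ u : ℝ) : ℂ)))
  let V' : ℝ → ℂ := fun u => (1 - Complex.I * ((s ^ 2 * (u * p u) : ℝ) : ℂ)) *
    Complex.exp (-(Complex.I * ((s ^ 2 * φ u : ℝ) : ℂ)))
  have hUV' : ∀ u, U u * V' u = (g u : ℂ) * Complex.exp (-(Complex.I * ((s ^ 2 * φ u : ℝ) : ℂ))) := by
    intro u
    have := sp_Dne (s ^ 2 * (u * p u))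
    simp only [U, V']
    rw [← mul_assoc, div_mul_cancel₀ _ this]
  have dU : ∀ u, HasDerivAt U (U' u) u := by
    intro u
    have a1 : HasDerivAt (fun u : ℝ => s ^ 2 * (u * p u)) (s ^ 2 * (p u + u * q u)) u := by
      have := (((hasDerivAt_id u).mul (dp u)).const_mul (s ^ 2))
      simpa using this
    have a2 := (a1.ofReal_comp.const_mul Complex.I).const_sub 1
    have a3 := (dg u).ofReal_comp.div a2 (sp_Dne _)
    refine a3.congr_deriv ?_
    have := sp_Dne (s ^ 2 * (u * p u))
    simp only [U']
    field_simp
    ring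
  have dV : ∀ u, HasDerivAt V (V' u) u := by
    intro u
    have a1 := (((dφ u).const_mul (s ^ 2)).ofReal_comp.const_mul Complex.I).neg.cexp
    have a2 := ((hasDerivAt_id u).ofReal_comp).mul a1
    refine a2.congr_deriv ?_
    simp only [V', id, Pi.neg_apply]
    push_cast
    ring
  have key := integral_mul_deriv_eq_deriv_mul_of_integrable (fun u _ => dU u) (fun u _ => dV u) ?_ ?_ ?_
  · simp_rw [hUV'] at key
    exact key
  · have : U * V' = fun u => (g u : ℂ) * Complex.exp (-(Complex.I * ((s ^ 2 * φ u : ℝ) : ℂ))) :=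
      funext hUV'
    rw [this]
    refine Integrable.mono' ig.norm (Continuous.aestronglyMeasurable (by fun_prop)) ?_
    refine Eventually.of_forall fun u => ?_
    rw [norm_mul, sp_normE]; simp
  · exact iF
  · refine Integrable.mono' (iug.norm.const_mul 2) ?_ ?_
    · refine Continuous.aestronglyMeasurable ?_
      exact (Continuous.div (by fun_prop) cD fun u => sp_Dne _).mul (by fun_prop)
    · refine Eventually.of_forall fun u => ?_
      simp only [Pi.mul_apply, U, V]
      rw [norm_mul, norm_mul, sp_normE, norm_div, Complex.norm_real, Complex.norm_real, norm_mul]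
      have hw : 0 ≤ s ^ 2 * (u * p u) := by
        have : 0 ≤ u * p u := le_trans (by positivity) (h1 u)
        positivity
      have := sp_normD _ hw
      have hh : 1 / 2 ≤ ‖1 - Complex.I * ((s ^ 2 * (u * p u) : ℝ) : ℂ)‖ := by linarith
      calc _ ≤ ‖g u‖ / (1 / 2) * (‖u‖ * 1) := by gcongr
        _ = _ := by ring

noncomputable def spL (a : ℝ) : ℂ := - ∫ x : ℝ,
  (Complex.I * ((2 * a * x ^ 2 : ℝ) : ℂ)) / (1 - Complex.I * ((a * x ^ 2 : ℝ) : ℂ)) ^ 2 *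
    Complex.exp (-(Complex.I * ((a * x ^ 2 / 2 : ℝ) : ℂ)))

lemma sp_taylor (φ p : ℝ → ℝ) (a : ℝ) (dφ : ∀ u, HasDerivAt φ (p u) u)
    (dp : HasDerivAt p a 0) (h0 : φ 0 = 0) (p0 : p 0 = 0) :
    Tendsto (fun u => φ u / u ^ 2) (𝓝[≠] 0) (𝓝 (a / 2)) := by
  have hs : Tendsto (fun u => p u / u) (𝓝[≠] 0) (𝓝 a) := by
    have := hasDerivAt_iff_tendsto_slope.1 dp
    refine this.congr fun u => ?_
    simp [slope_def_field, p0]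
  refine HasDerivAt.lhopital_zero_nhdsNE (f' := p) (g' := fun u => 2 * u)
    (Eventually.of_forall dφ) (Eventually.of_forall fun u => ?_) ?_ ?_ ?_ ?_
  · simpa using hasDerivAt_pow 2 u
  · filter_upwards [self_mem_nhdsWithin] with u hu
    simpa using hu
  · have := (dφ 0).continuousAt.tendsto
    rw [h0] at this
    exact this.mono_left nhdsWithin_le_nhds
  · have : Tendsto (fun u : ℝ => u ^ 2) (𝓝 0) (𝓝 (0 ^ 2)) := (continuous_pow 2).tendsto 0
    simp at this
    exact this.mono_left nhdsWithin_le_nhds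
  · refine (hs.div_const 2).congr fun u => ?_
    rw [div_div, mul_comm]

lemma sp_main (φ p q g g' : ℝ → ℝ) (c M C : ℝ) (hc : 0 < c) (hc1 : c ≤ 1) (hM : 0 ≤ M)
    (hC : 0 ≤ C) (h0 : φ 0 = 0) (p0 : p 0 = 0)
    (h1 : ∀ u, c * u ^ 2 ≤ u * p u) (h2 : ∀ u, |p u + u * q u| ≤ M * |u|)
    (hg : ∀ u, |g u| ≤ C) (hg' : ∀ u, |g' u| * |u| ≤ C)
    (dφ : ∀ u, HasDerivAt φ (p u) u) (dp : ∀ u, HasDerivAt p (q u) u) (hq : Continuous q)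
    (dg : ∀ u, HasDerivAt g (g' u) u) (cg' : Continuous g') (ig : Integrable g)
    (iug : Integrable (fun u => u * g u)) :
    Tendsto (fun s : ℝ => (s : ℂ) *
      ∫ u, (g u : ℂ) * Complex.exp (-(Complex.I * ((s ^ 2 * φ u : ℝ) : ℂ)))) atTop
      (𝓝 ((g 0 : ℂ) * spL (q 0))) := by
  have cφ : Continuous φ := continuous_iff_continuousAt.2 fun u => (dφ u).continuousAt
  have cp : Continuous p := continuous_iff_continuousAt.2 fun u => (dp u).continuousAt
  have cg : Continuous g := continuous_iff_continuousAt.2 fun u => (dg u).continuousAt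
  have cF : ∀ s, Continuous (spF φ p q g g' s) := by
    intro s
    have cD : Continuous fun u : ℝ => (1 - Complex.I * ((s ^ 2 * (u * p u) : ℝ) : ℂ)) := by fun_prop
    unfold spF
    refine Continuous.mul (Continuous.add ?_ ?_) (by fun_prop)
    · exact Continuous.div (by fun_prop) cD fun u => sp_Dne _
    · exact Continuous.div (by fun_prop) (cD.pow 2) fun u => pow_ne_zero _ (sp_Dne _)
  have hlim : Tendsto (fun s : ℝ => ∫ x, spF φ p q g g' s (x / s)) atTop
      (𝓝 (∫ x : ℝ, (g 0 : ℂ) * ((Complex.I * ((2 * q 0 * x ^ 2 : ℝ) : ℂ)) / (1 - Complex.I * ((q 0 * x ^ 2 : ℝ) : ℂ)) ^ 2 *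
    Complex.exp (-(Complex.I * ((q 0 * x ^ 2 / 2 : ℝ) : ℂ)))))) := by
    refine tendsto_integral_filter_of_dominated_convergence
      (fun x => ((2 * C + 4 * (C * M) / c) / c) * (1 + x ^ 2)⁻¹) ?_ ?_ ?_ ?_
    · exact Eventually.of_forall fun s =>
        ((cF s).comp (continuous_id.div_const s)).aestronglyMeasurable
    · filter_upwards [eventually_gt_atTop 0] with s hs
      refine Eventually.of_forall fun x => ?_
      have := sp_bound φ p q g g' c M C hc hc1 hM hC h1 h2 hg hg' s (x / s)
      rwa [mul_div_cancel₀ _ hs.ne'] at this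
    · exact integrable_inv_one_add_sq.const_mul _
    · have hae : ∀ᵐ x : ℝ, x ≠ 0 := by
        simp [ae_iff]
      filter_upwards [hae] with x hx
      have l0 : Tendsto (fun s : ℝ => x / s) atTop (𝓝 0) := tendsto_const_nhds.div_atTop tendsto_id
      have l0' : Tendsto (fun s : ℝ => x / s) atTop (𝓝[≠] 0) := by
        refine tendsto_nhdsWithin_iff.2 ⟨l0, ?_⟩
        filter_upwards [eventually_gt_atTop 0] with s hs
        simp [hx, hs.ne']
      have lg : Tendsto (fun s : ℝ => g (x / s)) atTop (𝓝 (g 0)) := (cg.tendsto 0).comp l0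
      have lg' : Tendsto (fun s : ℝ => g' (x / s)) atTop (𝓝 (g' 0)) := (cg'.tendsto 0).comp l0
      have lq : Tendsto (fun s : ℝ => q (x / s)) atTop (𝓝 (q 0)) := (hq.tendsto 0).comp l0
      have lp : Tendsto (fun s : ℝ => s ^ 2 * (x / s * p (x / s))) atTop (𝓝 (q 0 * x ^ 2)) := by
        have := (hasDerivAt_iff_tendsto_slope.1 (dp 0)).comp l0'
        refine (this.mul_const (x ^ 2)).congr' ?_
        filter_upwards [eventually_gt_atTop 0] with s hs
        simp [slope_def_field, p0]
        field_simp
      have lφ : Tendsto (fun s : ℝ => s ^ 2 * φ (x / s)) atTop (𝓝 (q 0 * x ^ 2 / 2)) := by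
        have := (sp_taylor φ p (q 0) dφ (dp 0) h0 p0).comp l0'
        have h3 := this.mul_const (x ^ 2)
        rw [div_mul_eq_mul_div] at h3
        refine h3.congr' ?_
        filter_upwards [eventually_gt_atTop 0] with s hs
        simp
        field_simp
      have lpq : Tendsto (fun s : ℝ => s ^ 2 * (p (x / s) + x / s * q (x / s)) * (x / s)) atTop
          (𝓝 (2 * q 0 * x ^ 2)) := by
        have := lp.add (lq.mul_const (x ^ 2))
        have e : q 0 * x ^ 2 + q 0 * x ^ 2 = 2 * q 0 * x ^ 2 := by ring
        rw [e] at this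
        refine this.congr' ?_
        filter_upwards [eventually_gt_atTop 0] with s hs
        field_simp
      have toC : ∀ {f : ℝ → ℝ} {b : ℝ}, Tendsto f atTop (𝓝 b) →
          Tendsto (fun s => (f s : ℂ)) atTop (𝓝 (b : ℂ)) := fun h =>
        (Complex.continuous_ofReal.tendsto _).comp h
      have lD := ((toC lp).const_mul Complex.I).const_sub 1
      have lE := ((toC lφ).const_mul Complex.I).neg.cexp
      have hne := sp_Dne (q 0 * x ^ 2)
      have T1 := (((toC lg').mul (toC l0)).div lD hne)
      have T2 := (((toC lg).mul ((toC lpq).const_mul Complex.I)).div (lD.pow 2) (pow_ne_zero 2 hne))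
      have T := (T1.add T2).mul lE
      have e : (((g' 0 : ℂ) * ((0 : ℝ) : ℂ) / (1 - Complex.I * ((q 0 * x ^ 2 : ℝ) : ℂ)) +
        (g 0 : ℂ) * (Complex.I * ((2 * q 0 * x ^ 2 : ℝ) : ℂ)) / (1 - Complex.I * ((q 0 * x ^ 2 : ℝ) : ℂ)) ^ 2) *
        Complex.exp (-(Complex.I * ((q 0 * x ^ 2 / 2 : ℝ) : ℂ)))) =
        (g 0 : ℂ) * ((Complex.I * ((2 * q 0 * x ^ 2 : ℝ) : ℂ)) / (1 - Complex.I * ((q 0 * x ^ 2 : ℝ) : ℂ)) ^ 2 *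
    Complex.exp (-(Complex.I * ((q 0 * x ^ 2 / 2 : ℝ) : ℂ)))) := by
        rw [Complex.ofReal_zero]; ring
      rw [e] at T
      refine T.congr fun s => ?_
      unfold spF
      simp only [Pi.div_apply]
      rw [Complex.ofReal_mul (s ^ 2 * (p (x / s) + x / s * q (x / s)))]
      ring
  rw [integral_const_mul] at hlim
  have := hlim.neg
  unfold spL
  rw [mul_neg]
  refine this.congr' ?_
  filter_upwards [eventually_gt_atTop 0] with s hs
  rw [sp_ibp φ p q g g' c M C hc hc1 hM hC h1 h2 hg hg' dφ dp hq dg cg' ig iug s hs,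
    Measure.integral_comp_div (fun u => spF φ p q g g' s u) s, abs_of_pos hs]
  simp

lemma sp_L (a : ℝ) (ha : 0 < a) : spL a ≠ 0 := by
  have key := sp_main (fun u => a * u ^ 2 / 2) (fun u => a * u) (fun _ => a)
    (fun u => Real.exp (-u ^ 2)) (fun u => Real.exp (-u ^ 2) * (-(2 * u))) (min a 1) (2 * a) 2
    (by positivity) (min_le_right _ _) (by positivity) (by norm_num) (by simp) (by simp)
    (fun u => by
      have := min_le_left a 1
      nlinarith [sq_nonneg u])
    (fun u => by
      have : a * u + u * a = (2 * a) * u := by ring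
      rw [this, abs_mul, abs_of_pos (by positivity : 0 < 2 * a)])
    (fun u => by
      rw [abs_of_pos (Real.exp_pos _)]
      have : Real.exp (-u ^ 2) ≤ 1 := Real.exp_le_one_iff.2 (by nlinarith [sq_nonneg u])
      linarith)
    (fun u => by
      rw [abs_mul, abs_of_pos (Real.exp_pos _), abs_neg, abs_mul, abs_two, mul_assoc, mul_assoc,
        abs_mul_abs_self, Real.exp_neg, inv_mul_le_iff₀ (Real.exp_pos _)]
      have := Real.add_one_le_exp (u ^ 2)
      nlinarith)
    (fun u => by
      have := ((hasDerivAt_pow 2 u).const_mul a).div_const 2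
      refine this.congr_deriv ?_
      simp; ring)
    (fun u => by simpa using (hasDerivAt_id u).const_mul a)
    continuous_const
    (fun u => by
      have := (hasDerivAt_pow 2 u).neg.exp
      simpa using this)
    (by fun_prop)
    (by simpa using integrable_exp_neg_mul_sq (b := 1) one_pos)
    (by simpa using integrable_mul_exp_neg_mul_sq (b := 1) one_pos)
  intro h
  rw [h, mul_zero] at key
  have key2 := (key.norm).pow 2
  have : Tendsto (fun s : ℝ => Real.pi * (‖(s : ℂ) ^ 2‖ / ‖1 + Complex.I * ((s ^ 2 * a / 2 : ℝ) : ℂ)‖)) atTop (𝓝 0) := by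
    have e0 : (‖(0 : ℂ)‖ ^ 2 : ℝ) = 0 := by simp
    rw [e0] at key2
    refine key2.congr fun s => ?_
    have e : ∀ u : ℝ, ((Real.exp (-u ^ 2) : ℝ) : ℂ) * Complex.exp (-(Complex.I * ((s ^ 2 * (a * u ^ 2 / 2) : ℝ) : ℂ))) =
        Complex.exp (-(1 + Complex.I * ((s ^ 2 * a / 2 : ℝ) : ℂ)) * (u : ℂ) ^ 2) := by
      intro u
      rw [Complex.ofReal_exp, ← Complex.exp_add]
      congr 1; push_cast; ring
    simp_rw [e]
    rw [← norm_pow, mul_pow, integral_gaussian_sq_complex (by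
      rw [Complex.add_re, Complex.I_mul_re, Complex.ofReal_im]; simp)]
    rw [norm_mul, norm_div, Complex.norm_real, Real.norm_eq_abs, abs_of_pos Real.pi_pos]
    ring
  have h3 : ∀ᶠ s : ℝ in atTop, Real.pi * (1 / (1 + a)) ≤ Real.pi * (‖(s : ℂ) ^ 2‖ / ‖1 + Complex.I * ((s ^ 2 * a / 2 : ℝ) : ℂ)‖) := by
    filter_upwards [eventually_ge_atTop 1] with s hs
    have hs2 : 1 ≤ s ^ 2 := by nlinarith
    have n1 : ‖(s : ℂ) ^ 2‖ = s ^ 2 := by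
      rw [norm_pow, Complex.norm_real, Real.norm_eq_abs, sq_abs]
    have n2 : ‖1 + Complex.I * ((s ^ 2 * a / 2 : ℝ) : ℂ)‖ ≤ 1 + s ^ 2 * a / 2 := by
      refine (norm_add_le _ _).trans ?_
      rw [norm_mul, Complex.norm_I, Complex.norm_real, Real.norm_eq_abs, abs_of_nonneg (by positivity)]
      simp
    have n3 : 0 < ‖1 + Complex.I * ((s ^ 2 * a / 2 : ℝ) : ℂ)‖ := by
      rw [norm_pos_iff]
      intro h
      have := congrArg Complex.re h
      rw [Complex.add_re, Complex.I_mul_re, Complex.ofReal_im] at this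
      simp at this
    rw [n1]
    refine mul_le_mul_of_nonneg_left ?_ Real.pi_pos.le
    rw [div_le_div_iff₀ (by positivity) n3]
    nlinarith
  have h4 := ge_of_tendsto this h3
  have : 0 < Real.pi * (1 / (1 + a)) := by positivity
  linarith

lemma sp_phase (A α : ℝ) (hA : 0 < A) (hα0 : 0 < α) (hα1 : α < 1) :
    ∃ (φ p q : ℝ → ℝ) (c M : ℝ), 0 < c ∧ c ≤ 1 ∧ 0 ≤ M ∧ φ 0 = 0 ∧ p 0 = 0 ∧
      (∀ u, c * u ^ 2 ≤ u * p u) ∧ (∀ u, |p u + u * q u| ≤ M * |u|) ∧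
      (∀ u, HasDerivAt φ (p u) u) ∧ (∀ u, HasDerivAt p (q u) u) ∧ Continuous q ∧ 0 < q 0 ∧
      ∀ u, |u| < 1 / 2 → φ u = A * (1 - α) + A * α * (1 + u) - A * (1 + u) ^ α := by
  let k : ℝ → ℝ := fun u => max (1 / 2) (min (3 / 2) (1 + u))
  have k1 : ∀ u, 1 / 2 ≤ k u := fun u => le_max_left _ _
  have k2 : ∀ u, k u ≤ 3 / 2 := fun u => max_le (by norm_num) (min_le_left _ _)
  have k3 : ∀ u, |u| ≤ 1 / 2 → k u = 1 + u := by
    intro u hu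
    have := abs_le.1 hu
    simp only [k]
    rw [min_eq_right (by linarith), max_eq_right (by linarith)]
  have ck : Continuous k := by fun_prop
  have hK : 0 < A * α * (1 - α) := by
    have : 0 < 1 - α := by linarith
    positivity
  let q : ℝ → ℝ := fun u => A * α * (1 - α) * (k u) ^ (α - 2)
  have cq : Continuous q := continuous_const.mul
    (ck.rpow_const fun u => Or.inl (by have := k1 u; linarith))
  let p : ℝ → ℝ := fun u => ∫ v in (0:ℝ)..u, q v
  have dp : ∀ u, HasDerivAt p (q u) u := fun u =>
    intervalIntegral.integral_hasDerivAt_right (cq.intervalIntegrable _ _)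
      cq.stronglyMeasurable.stronglyMeasurableAtFilter cq.continuousAt
  have cp : Continuous p := continuous_iff_continuousAt.2 fun u => (dp u).continuousAt
  let φ : ℝ → ℝ := fun u => ∫ v in (0:ℝ)..u, p v
  have dφ : ∀ u, HasDerivAt φ (p u) u := fun u =>
    intervalIntegral.integral_hasDerivAt_right (cp.intervalIntegrable _ _)
      cp.stronglyMeasurable.stronglyMeasurableAtFilter cp.continuousAt
  have p0 : p 0 = 0 := by simp [p]
  let c0 := A * α * (1 - α) * (3 / 2 : ℝ) ^ (α - 2)
  let M0 := A * α * (1 - α) * (1 / 2 : ℝ) ^ (α - 2)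
  have hc0 : 0 < c0 := by positivity
  have hM0 : 0 < M0 := by positivity
  have q1 : ∀ u, c0 ≤ q u := fun u => mul_le_mul_of_nonneg_left
    (Real.rpow_le_rpow_of_nonpos (by have := k1 u; linarith) (k2 u) (by linarith)) hK.le
  have q2 : ∀ u, q u ≤ M0 := fun u => mul_le_mul_of_nonneg_left
    (Real.rpow_le_rpow_of_nonpos (by norm_num) (k1 u) (by linarith)) hK.le
  -- mean value
  have mv : ∀ u, ∃ m, c0 ≤ m ∧ m ≤ M0 ∧ p u = m * u := by
    intro u
    rcases eq_or_ne u 0 with rfl | hu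
    · exact ⟨c0, le_rfl, (q1 0).trans (q2 0), by simp [p0]⟩
    · have : ∃ v, q v = p u / u := by
        rcases lt_or_gt_of_ne hu with h | h
        · obtain ⟨v, _, hv⟩ := exists_hasDerivAt_eq_slope p q h cp.continuousOn fun x _ => dp x
          refine ⟨v, hv.trans ?_⟩
          rw [p0, zero_sub, zero_sub, neg_div_neg_eq]
        · obtain ⟨v, _, hv⟩ := exists_hasDerivAt_eq_slope p q h cp.continuousOn fun x _ => dp x
          refine ⟨v, hv.trans ?_⟩
          rw [p0, sub_zero, sub_zero]
      obtain ⟨v, hv⟩ := this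
      exact ⟨q v, q1 v, q2 v, by rw [hv]; field_simp⟩
  have sub : ∀ u v : ℝ, |u| < 1 / 2 → v ∈ Set.uIcc 0 u → |v| < 1 / 2 := by
    intro u v hu hv
    have := Set.abs_sub_left_of_mem_uIcc hv
    simp at this
    linarith
  have hp : ∀ u, |u| < 1 / 2 → p u = A * α - A * α * (1 + u) ^ (α - 1) := by
    intro u hu
    have h : ∀ v ∈ Set.uIcc 0 u, HasDerivAt (fun v => A * α - A * α * (1 + v) ^ (α - 1)) (q v) v := by
      intro v hv
      have h3 := sub u v hu hv
      have h4 := abs_lt.1 h3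
      have := (((hasDerivAt_id v).const_add 1).rpow_const (p := α - 1)
        (Or.inl (by simp; linarith))).const_mul (A * α) |>.const_sub (A * α)
      refine this.congr_deriv ?_
      simp only [q, id]
      rw [k3 v h3.le, show α - 1 - 1 = α - 2 by ring]
      ring
    have := intervalIntegral.integral_eq_sub_of_hasDerivAt h (cq.intervalIntegrable _ _)
    simp only [p]
    rw [this]; simp
  have hφ : ∀ u, |u| < 1 / 2 → φ u = A * (1 - α) + A * α * (1 + u) - A * (1 + u) ^ α := by
    intro u hu
    have h : ∀ v ∈ Set.uIcc 0 u, HasDerivAt (fun v => A * α * (1 + v) - A * (1 + v) ^ α) (p v) v := by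
      intro v hv
      have h3 := sub u v hu hv
      have h4 := abs_lt.1 h3
      have := (((hasDerivAt_id v).const_add 1).const_mul (A * α)).sub
        ((((hasDerivAt_id v).const_add 1).rpow_const (p := α)
        (Or.inl (by simp; linarith))).const_mul A)
      refine this.congr_deriv ?_
      rw [hp v h3]
      simp only [id]
      ring
    have := intervalIntegral.integral_eq_sub_of_hasDerivAt h (cp.intervalIntegrable _ _)
    simp only [φ]
    rw [this]; simp; ring
  refine ⟨φ, p, q, min c0 1, 2 * M0, by positivity, min_le_right _ _, by positivity, by simp [φ],
    p0, ?_, ?_, dφ, dp, cq, hc0.trans_le (q1 0), hφ⟩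
  · intro u
    obtain ⟨m, h1, h2, h3⟩ := mv u
    rw [h3]
    have := min_le_left c0 1
    nlinarith [sq_nonneg u]
  · intro u
    obtain ⟨m, h1, h2, h3⟩ := mv u
    rw [h3, show m * u + u * q u = (m + q u) * u by ring, abs_mul]
    refine mul_le_mul_of_nonneg_right ?_ (abs_nonneg _)
    have := q1 u
    have := q2 u
    rw [abs_of_nonneg (by linarith)]
    linarith

/-- Sharpness of the `|t|^{-1/2}` decay for the fractional Schrödinger semigroup
`e^{it𝓛^α}` on the Heisenberg group: with `s₀ = α·4^α·n^α`, the oscillatory integral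
`∫ e^{it(−λs₀ + 4^α n^α λ^α)} Q(λ) λ^n dλ` is comparable to `t^{-1/2}` as `t → ∞`. -/
theorem statement15 (n : ℕ) (hn : 1 ≤ n) (α : ℝ) (hα0 : 0 < α) (hα1 : α < 1) :
    ∃ ε : ℝ, ε ∈ Set.Ioo (0 : ℝ) 1 ∧
      ∀ Q : ℝ → ℝ, ContDiff ℝ (⊤ : ℕ∞) Q → HasCompactSupport Q →
        tsupport Q ⊆ Set.Ioo (1 - ε) (1 + ε) → Q 1 = 1 →
        ∃ c₁ c₂ T : ℝ, 0 < c₁ ∧ 0 < c₂ ∧ 0 < T ∧ ∀ t : ℝ, T ≤ t →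
          ‖∫ lam : ℝ,
              Complex.exp (Complex.I * t *
                ((-(lam * (α * (4 : ℝ) ^ α * (n : ℝ) ^ α)) +
                  (4 : ℝ) ^ α * (n : ℝ) ^ α * lam ^ α : ℝ) : ℂ)) *
                ((Q lam * lam ^ n : ℝ) : ℂ)‖ ∈
            Set.Icc (c₁ * t ^ (-(1 / 2) : ℝ)) (c₂ * t ^ (-(1 / 2) : ℝ)) := by
  have hn0 : (0 : ℝ) < n := by exact_mod_cast hn
  set A : ℝ := (4 : ℝ) ^ α * (n : ℝ) ^ α with hAdef
  have hA : 0 < A := by positivity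
  obtain ⟨φ, p, q, c, M, hc, hc1, hM, h0, p0, h1, h2, dφ, dp, cq, hq0, hφ⟩ :=
    sp_phase A α hA hα0 hα1
  refine ⟨1 / 2, ⟨by norm_num, by norm_num⟩, ?_⟩
  intro Q hQ hQc hQs hQ1
  let g : ℝ → ℝ := fun u => Q (1 + u) * (1 + u) ^ n
  have sg : ContDiff ℝ 1 g := by
    have hQ' : ContDiff ℝ 1 Q := hQ.of_le (by exact_mod_cast le_top)
    exact (hQ'.comp (contDiff_const.add contDiff_id)).mul ((contDiff_const.add contDiff_id).pow n)
  have gc : HasCompactSupport g :=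
    (hQc.comp_homeomorph (Homeomorph.addLeft (1 : ℝ))).mul_right
  have cg : Continuous g := sg.continuous
  have cg' : Continuous (deriv g) := sg.continuous_deriv le_rfl
  have gc' : HasCompactSupport (deriv g) := gc.deriv
  have dg : ∀ u, HasDerivAt g (deriv g u) u := fun u =>
    (sg.differentiable (by norm_num) u).hasDerivAt
  obtain ⟨C1, hC1⟩ := gc.exists_bound_of_continuous cg
  obtain ⟨C2, hC2⟩ := (gc'.mul_right (f' := fun u : ℝ => u)).exists_bound_of_continuous
    (cg'.mul continuous_id)
  have hC1' : 0 ≤ C1 := (norm_nonneg _).trans (hC1 0)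
  have main := sp_main φ p q g (deriv g) c M (max C1 C2) hc hc1 hM
    (hC1'.trans (le_max_left _ _)) h0 p0 h1 h2 (fun u => (hC1 u).trans (le_max_left _ _))
    (fun u => by
      have := hC2 u
      simp only [Pi.mul_apply, norm_mul, Real.norm_eq_abs] at this
      exact this.trans (le_max_right _ _))
    dφ dp cq dg cg' (cg.integrable_of_hasCompactSupport gc)
    ((continuous_id.mul cg).integrable_of_hasCompactSupport gc.mul_left)
  have hg0 : g 0 = 1 := by simp [g, hQ1]
  rw [hg0, Complex.ofReal_one, one_mul] at main
  have hL := norm_pos_iff.2 (sp_L (q 0) hq0)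
  have mn := main.norm
  have ev := (mn.eventually (Ioo_mem_nhds (half_lt_self hL) (lt_two_mul_self hL)))
  obtain ⟨S, hS⟩ := eventually_atTop.1 ev
  refine ⟨‖spL (q 0)‖ / 2, 2 * ‖spL (q 0)‖, (max S 1) ^ 2, by positivity, by positivity,
    by positivity, ?_⟩
  intro t ht
  have htp : 0 < t := lt_of_lt_of_le (by positivity) ht
  have hst : max S 1 ≤ Real.sqrt t := Real.le_sqrt_of_sq_le ht
  have hs := hS (Real.sqrt t) ((le_max_left _ _).trans hst)
  have hsp : 0 < Real.sqrt t := Real.sqrt_pos.2 htp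
  have eI : ‖∫ lam : ℝ,
              Complex.exp (Complex.I * t *
                ((-(lam * (α * (4 : ℝ) ^ α * (n : ℝ) ^ α)) +
                  (4 : ℝ) ^ α * (n : ℝ) ^ α * lam ^ α : ℝ) : ℂ)) *
                ((Q lam * lam ^ n : ℝ) : ℂ)‖ =
      ‖∫ u, (g u : ℂ) * Complex.exp (-(Complex.I * ((Real.sqrt t ^ 2 * φ u : ℝ) : ℂ)))‖ := by
    rw [← integral_add_left_eq_self (μ := volume) _ (1 : ℝ)]
    have : ∀ u : ℝ, Complex.exp (Complex.I * t *
                ((-((1 + u) * (α * (4 : ℝ) ^ α * (n : ℝ) ^ α)) +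
                  (4 : ℝ) ^ α * (n : ℝ) ^ α * (1 + u) ^ α : ℝ) : ℂ)) *
                ((Q (1 + u) * (1 + u) ^ n : ℝ) : ℂ) =
        Complex.exp (((t * (A * (1 - α)) : ℝ) : ℂ) * Complex.I) *
          ((g u : ℂ) * Complex.exp (-(Complex.I * ((Real.sqrt t ^ 2 * φ u : ℝ) : ℂ)))) := by
      intro u
      by_cases hu : |u| < 1 / 2
      · rw [hφ u hu, Real.sq_sqrt htp.le, mul_left_comm (Complex.exp _) (g u : ℂ), ← Complex.exp_add,
          mul_comm (Complex.exp _)]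
        congr 2
        rw [mul_assoc α, ← hAdef]
        push_cast
        ring
      · have : Q (1 + u) = 0 := by
          by_contra hne
          have := hQs (subset_tsupport _ hne)
          apply hu
          rw [abs_lt]
          constructor <;> linarith [this.1, this.2]
        simp [g, this]
    simp_rw [this]
    rw [integral_const_mul, norm_mul, Complex.norm_exp_ofReal_mul_I, one_mul]
  rw [eI]
  rw [norm_mul, Complex.norm_real, Real.norm_eq_abs, abs_of_pos hsp] at hs
  have et : t ^ (-(1 / 2) : ℝ) = (Real.sqrt t)⁻¹ := by
    rw [Real.rpow_neg htp.le, Real.sqrt_eq_rpow]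
  rw [et]
  constructor
  · rw [← div_eq_mul_inv, div_le_iff₀ hsp]
    linarith [hs.1]
  · rw [← div_eq_mul_inv, le_div_iff₀ hsp]
    linarith [hs.2]
end
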